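/- Let μ be a probability measure on ℝ with mean ∫ t dμ(t) = 0 and variance σ² = ∫ t² dμ(t) ∈ (0,∞). Then there exists a unique probability measure μ° on ℝ (the free zero bias of μ) such that G_{μ°}(z)² = (z·G_μ(z) − 1)/σ² for all z ∈ ℂ₊. Moreover μ° = (μ^□)^♭, the El Gordo transform of the square bias of μ. -/

import Mathlib

open MeasureTheory Complex

/-- The Cauchy transform of a measure on ℝ. -/
noncomputable def cauchy (μ : Measure ℝ) (z : ℂ) : ℂ := ∫ t, (z - (t : ℂ))⁻¹ ∂μ

/-- The square bias of a measure on ℝ with finite second moment. -/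
noncomputable def sqBias (μ : Measure ℝ) : Measure ℝ :=
  if (∫ t, t ^ 2 ∂μ) = 0 then Measure.dirac 0
  else μ.withDensity fun t => ENNReal.ofReal (t ^ 2 / ∫ s, s ^ 2 ∂μ)


open Filter Topology

lemma sub_ne_zero_of_im {z : ℂ} (hz : z.im ≠ 0) (t : ℝ) : z - (t : ℂ) ≠ 0 := by
  intro h
  apply hz
  have := congrArg Complex.im h
  simpa using this

lemma norm_inv_le {z : ℂ} (hz : 0 < z.im) (t : ℝ) : ‖(z - (t : ℂ))⁻¹‖ ≤ z.im⁻¹ := by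
  rw [norm_inv]
  apply inv_anti₀ hz
  have := Complex.abs_im_le_norm (z - (t : ℂ))
  simp only [sub_im, ofReal_im, sub_zero] at this
  exact (le_abs_self _).trans this

lemma continuous_kernel {z : ℂ} (hz : 0 < z.im) : Continuous fun t : ℝ => (z - (t : ℂ))⁻¹ := by
  apply Continuous.inv₀ (by fun_prop)
  exact sub_ne_zero_of_im hz.ne'

lemma integrable_kernel (μ : Measure ℝ) [IsFiniteMeasure μ] {z : ℂ} (hz : 0 < z.im) :
    Integrable (fun t : ℝ => (z - (t : ℂ))⁻¹) μ :=
  Integrable.of_bound (continuous_kernel hz).aestronglyMeasurable z.im⁻¹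
    (Eventually.of_forall (norm_inv_le hz))

lemma kernel_im {z : ℂ} (t : ℝ) :
    ((z - (t : ℂ))⁻¹).im = -(z.im / ((z.re - t) ^ 2 + z.im ^ 2)) := by
  rw [Complex.inv_im, Complex.normSq_apply]
  simp
  ring

lemma cauchy_im' (μ : Measure ℝ) {z : ℂ} 
    (hi : Integrable (fun t : ℝ => (z - (t : ℂ))⁻¹) μ) :
    -(cauchy μ z).im = ∫ t, z.im / ((z.re - t) ^ 2 + z.im ^ 2) ∂μ := by
  have h : (∫ t, (z - (t : ℂ))⁻¹ ∂μ).im = ∫ t, ((z - (t : ℂ))⁻¹).im ∂μ := by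
    have := integral_im hi
    simpa using this.symm
  rw [cauchy, h, ← integral_neg]
  congr 1
  ext t
  rw [kernel_im]; ring

lemma cauchy_im_neg (μ : Measure ℝ) [IsProbabilityMeasure μ] {z : ℂ} (hz : 0 < z.im) :
    (cauchy μ z).im < 0 := by
  have hi := integrable_kernel μ hz
  have h := cauchy_im' μ hi
  have hpos : ∀ t : ℝ, 0 < z.im / ((z.re - t) ^ 2 + z.im ^ 2) := fun t => by positivity
  have hint : Integrable (fun t : ℝ => z.im / ((z.re - t) ^ 2 + z.im ^ 2)) μ := by
    have := hi.im.neg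
    refine this.congr (Eventually.of_forall fun t => ?_)
    have := @kernel_im z t
    simp only [Pi.neg_apply, RCLike.im_to_complex]
    rw [this]; ring
  have : 0 < ∫ t, z.im / ((z.re - t) ^ 2 + z.im ^ 2) ∂μ := by
    rw [integral_pos_iff_support_of_nonneg (fun t => (hpos t).le) hint]
    have : Function.support (fun t : ℝ => z.im / ((z.re - t) ^ 2 + z.im ^ 2)) = Set.univ := by
      ext t; simpa using (hpos t).ne'
    rw [this]; simp
  linarith

lemma differentiableAt_cauchy (μ : Measure ℝ) [IsFiniteMeasure μ] {z : ℂ} (hz : 0 < z.im) :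
    DifferentiableAt ℂ (cauchy μ) z := by
  have : cauchy μ = fun a => - resolventTransform μ a := by
    ext a
    rw [cauchy, resolventTransform_apply, ← integral_neg]
    congr 1
    ext t
    rw [resolvent, Ring.inverse_eq_inv']
    rw [← inv_neg]; simp
  rw [this]
  apply DifferentiableAt.neg
  refine (hasDerivAt_resolventTransform z ?_).differentiableAt
  rintro ⟨t, -, rfl⟩
  simp at hz

lemma integrable_poisson {y : ℝ} (hy : 0 < y) (t : ℝ) :
    Integrable (fun x : ℝ => y / ((x - t) ^ 2 + y ^ 2)) := by
  have h := (integrable_inv_one_add_sq.comp_mul_left' (R := y⁻¹) (by positivity)).comp_sub_right t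
  refine (h.const_mul y⁻¹).congr (Eventually.of_forall fun x => ?_)
  simp only
  field_simp
  ring

lemma integral_shift {y : ℝ} (hy : 0 < y) (t : ℝ) (f : ℝ → ℝ) :
    ∫ x : ℝ, f x * (y / ((x - t) ^ 2 + y ^ 2)) = ∫ s : ℝ, f (t + y * s) * (1 + s ^ 2)⁻¹ := by
  have h1 := integral_add_left_eq_self (μ := volume) (fun x => f x * (y / ((x - t) ^ 2 + y ^ 2))) t
  have h2 := Measure.integral_comp_mul_left (fun x => f (t + x) * (y / ((t + x - t) ^ 2 + y ^ 2))) y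
  rw [← h1]
  rw [abs_of_pos (by positivity), smul_eq_mul] at h2
  rw [eq_comm, inv_mul_eq_iff_eq_mul₀ hy.ne'] at h2
  rw [h2, ← integral_const_mul]
  congr 1
  ext s
  field_simp
  ring

lemma integral_poisson {y : ℝ} (hy : 0 < y) (t : ℝ) :
    ∫ x : ℝ, (y / ((x - t) ^ 2 + y ^ 2)) = Real.pi := by
  have := integral_shift hy t (fun _ => 1)
  simpa using this

lemma cauchy_smooth (μ : Measure ℝ) [IsFiniteMeasure μ] (f : BoundedContinuousFunction ℝ ℝ) {y : ℝ}
    (hy : 0 < y) :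
    ∫ x : ℝ, f x * (-(cauchy μ ⟨x, y⟩).im) = ∫ t, (∫ s : ℝ, f (t + y * s) * (1 + s ^ 2)⁻¹) ∂μ := by
  have h1 : ∀ x : ℝ, f x * (-(cauchy μ ⟨x, y⟩).im) =
      ∫ t, f x * (y / ((x - t) ^ 2 + y ^ 2)) ∂μ := by
    intro x
    rw [cauchy_im' μ (integrable_kernel μ hy), integral_const_mul]
  simp_rw [h1]
  rw [integral_integral_swap]
  · congr 1
    ext t
    exact integral_shift hy t f
  · have hc : Continuous (Function.uncurry fun x t : ℝ => y / ((x - t) ^ 2 + y ^ 2)) := by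
      apply Continuous.div (by fun_prop) (by fun_prop)
      rintro ⟨a, b⟩
      simp only
      positivity
    have hk : Integrable (Function.uncurry fun x t : ℝ => y / ((x - t) ^ 2 + y ^ 2))
        (volume.prod μ) := by
      rw [integrable_prod_iff' hc.aestronglyMeasurable]
      constructor
      · exact Eventually.of_forall fun t => integrable_poisson hy t
      · have : ∀ t : ℝ, ∫ x : ℝ, ‖Function.uncurry (fun x t : ℝ => y / ((x - t) ^ 2 + y ^ 2)) (x, t)‖
            = Real.pi := by
          intro t
          rw [← integral_poisson hy t]
          congr 1
          ext x
          simp only [Function.uncurry]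
          rw [Real.norm_of_nonneg (by positivity)]
        simp_rw [this]
        exact integrable_const _
    refine (hk.bdd_mul (c := ‖f‖) (f := fun p : ℝ × ℝ => f p.1) ?_ ?_)
    · exact (f.continuous.comp continuous_fst).aestronglyMeasurable
    · exact Eventually.of_forall fun p => f.norm_coe_le_norm _

lemma cauchy_tendsto (μ : Measure ℝ) [IsFiniteMeasure μ] (f : BoundedContinuousFunction ℝ ℝ) :
    Tendsto (fun n : ℕ => ∫ t, (∫ s : ℝ, f (t + (1 / ((n : ℝ) + 1)) * s) * (1 + s ^ 2)⁻¹) ∂μ) atTop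
      (𝓝 (∫ t, f t * Real.pi ∂μ)) := by
  have hb : ∀ (t y s : ℝ), ‖f (t + y * s) * (1 + s ^ 2)⁻¹‖ ≤ ‖f‖ * (1 + s ^ 2)⁻¹ := by
    intro t y s
    rw [norm_mul, Real.norm_of_nonneg (by positivity : 0 ≤ (1 + s ^ 2)⁻¹)]
    gcongr
    exact f.norm_coe_le_norm _
  have hbi : Integrable (fun s : ℝ => ‖f‖ * (1 + s ^ 2)⁻¹) := integrable_inv_one_add_sq.const_mul _
  have hc : Continuous (fun s : ℝ => (1 + s ^ 2)⁻¹) :=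
    Continuous.inv₀ (by fun_prop) (fun s => by positivity)
  apply tendsto_integral_of_dominated_convergence (fun _ => ‖f‖ * Real.pi)
  · intro n
    apply StronglyMeasurable.aestronglyMeasurable
    apply StronglyMeasurable.integral_prod_right
      (f := fun t s : ℝ => f (t + (1 / ((n : ℝ) + 1)) * s) * (1 + s ^ 2)⁻¹)
    apply Continuous.stronglyMeasurable
    simp only [Function.uncurry_def]
    exact (f.continuous.comp (by fun_prop)).mul (hc.comp continuous_snd)
  · exact integrable_const _
  · intro n
    refine Eventually.of_forall fun t => ?_
    refine (norm_integral_le_of_norm_le hbi (Eventually.of_forall fun s => hb t _ s)).trans ?_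
    rw [integral_const_mul, integral_univ_inv_one_add_sq]
  · refine Eventually.of_forall fun t => ?_
    have : f t * Real.pi = ∫ s : ℝ, f t * (1 + s ^ 2)⁻¹ := by
      rw [integral_const_mul, integral_univ_inv_one_add_sq]
    rw [this]
    apply tendsto_integral_of_dominated_convergence (fun s => ‖f‖ * (1 + s ^ 2)⁻¹)
    · intro n
      have := f.continuous
      exact Continuous.aestronglyMeasurable (by fun_prop)
    · exact hbi
    · intro n; exact Eventually.of_forall fun s => hb t _ s
    · refine Eventually.of_forall fun s => ?_
      apply Tendsto.mul_const
      have h0 : Tendsto (fun n : ℕ => t + (1 / ((n : ℝ) + 1)) * s) atTop (𝓝 (t + 0 * s)) :=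
        (tendsto_one_div_add_atTop_nhds_zero_nat.mul_const s).const_add t
      rw [zero_mul, add_zero] at h0
      exact (f.continuous.tendsto t).comp h0

lemma cauchy_unique (μ ν : Measure ℝ) [IsFiniteMeasure μ] [IsFiniteMeasure ν]
    (h : ∀ z : ℂ, 0 < z.im → cauchy μ z = cauchy ν z) : μ = ν := by
  apply ext_of_forall_integral_eq_of_IsFiniteMeasure
  intro f
  have h1 := cauchy_tendsto μ f
  have h2 := cauchy_tendsto ν f
  have : ∀ n : ℕ, ∫ t, (∫ s : ℝ, f (t + (1 / ((n : ℝ) + 1)) * s) * (1 + s ^ 2)⁻¹) ∂μ =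
      ∫ t, (∫ s : ℝ, f (t + (1 / ((n : ℝ) + 1)) * s) * (1 + s ^ 2)⁻¹) ∂ν := by
    intro n
    have hy : 0 < 1 / ((n : ℝ) + 1) := by positivity
    rw [← cauchy_smooth μ f hy, ← cauchy_smooth ν f hy]
    congr 1
    ext x
    rw [h ⟨x, _⟩ hy]
  simp_rw [this] at h1
  have h3 := tendsto_nhds_unique h1 h2
  rw [integral_mul_const, integral_mul_const] at h3
  exact mul_right_cancel₀ Real.pi_ne_zero h3

lemma line_integral_zero (g : ℂ → ℂ) (δ : ℝ) (hδ : 0 < δ)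
    (hd : DifferentiableOn ℂ g {w | -δ < w.im})
    (hi : Integrable (fun x : ℝ => g x))
    (hdec : ∀ ε > 0, ∃ R₀ : ℝ, ∀ w : ℂ, 0 ≤ w.im → R₀ ≤ ‖w‖ → ‖g w‖ * ‖w‖ ≤ ε) :
    ∫ x : ℝ, g x = 0 := by
  have h1 : Tendsto (fun R : ℝ => ∫ x in (-R)..R, g x) atTop (𝓝 (∫ x : ℝ, g x)) :=
    intervalIntegral_tendsto_integral hi tendsto_neg_atTop_atBot tendsto_id
  refine tendsto_nhds_unique h1 ?_
  rw [Metric.tendsto_atTop]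
  intro ε hε
  obtain ⟨R₀, hR₀⟩ := hdec (ε / 8) (by positivity)
  refine ⟨max R₀ 1, fun R hR => ?_⟩
  have hR1 : 0 < R := lt_of_lt_of_le one_pos ((le_max_right _ _).trans hR)
  have hR2 : R₀ ≤ R := (le_max_left _ _).trans hR
  have hrect := integral_boundary_rect_eq_zero_of_differentiableOn g (⟨-R, 0⟩ : ℂ) (⟨R, R⟩ : ℂ) (by
    apply hd.mono
    intro w hw
    have := hw.2
    simp only [Set.mem_preimage, Set.uIcc_of_le hR1.le, Set.mem_Icc] at this
    simp only [Set.mem_ofPred_eq]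
    linarith [this.1])
  simp only [ofReal_zero, zero_mul, add_zero] at hrect
  have hb : ∀ w : ℂ, 0 ≤ w.im → R ≤ ‖w‖ → ‖g w‖ ≤ ε / 8 / R := by
    intro w hw hwR
    have h := hR₀ w hw (hR2.trans hwR)
    rw [le_div_iff₀ hR1]
    exact (mul_le_mul_of_nonneg_left hwR (norm_nonneg _)).trans h
  have htop : ‖∫ x in (-R)..R, g (x + R * I)‖ ≤ ε / 8 / R * |R - -R| := by
    apply intervalIntegral.norm_integral_le_of_norm_le_const
    intro x _
    apply hb
    · simpa using hR1.le
    · have := Complex.abs_im_le_norm (x + R * I : ℂ)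
      simp at this
      exact (le_abs_self _).trans this
  have hside : ∀ a : ℝ, |a| = R → ‖∫ y in (0:ℝ)..R, g (a + y * I)‖ ≤ ε / 8 / R * |R - 0| := by
    intro a ha
    apply intervalIntegral.norm_integral_le_of_norm_le_const
    intro y hy
    rw [Set.uIoc_of_le hR1.le] at hy
    apply hb
    · simpa using hy.1.le
    · have := Complex.abs_re_le_norm (a + y * I : ℂ)
      simp at this
      rwa [ha] at this
  have hr := hside R (abs_of_pos hR1)
  have hl := hside (-R) (by rw [abs_neg, abs_of_pos hR1])
  have heq : ∫ x in (-R)..R, g x = (∫ x in (-R)..R, g (x + R * I)) -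
      I • (∫ y in (0:ℝ)..R, g (R + y * I)) + I • (∫ y in (0:ℝ)..R, g ((-R : ℝ) + y * I)) := by
    linear_combination hrect
  have e1 : ε / 8 / R * |R - -R| = ε / 4 := by
    rw [sub_neg_eq_add, abs_of_pos (by linarith)]; field_simp; ring
  have e2 : ε / 8 / R * |R - 0| = ε / 8 := by
    rw [sub_zero, abs_of_pos hR1]; field_simp
  rw [dist_zero_right, heq]
  have n1 := norm_add_le ((∫ x in (-R)..R, g (x + R * I)) -
      I • (∫ y in (0:ℝ)..R, g (R + y * I))) (I • (∫ y in (0:ℝ)..R, g ((-R : ℝ) + y * I)))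
  have n2 := norm_sub_le (∫ x in (-R)..R, g (x + R * I)) (I • (∫ y in (0:ℝ)..R, g (R + y * I)))
  rw [norm_smul, norm_I, one_mul] at n1 n2
  linarith

lemma integrable_line (h : ℂ → ℂ) (hc : Continuous (fun x : ℝ => h x))
    (C : ℝ) (hC : ∀ x : ℝ, ‖h x‖ ≤ C * (1 + |x|) ^ (-(1/2) : ℝ)) (z : ℂ) (hz : z.im ≠ 0) :
    Integrable (fun x : ℝ => h x * ((x : ℂ) - z)⁻¹) := by
  have hne : ∀ x : ℝ, (x : ℂ) - z ≠ 0 := by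
    intro x
    rw [← neg_ne_zero, neg_sub]
    exact sub_ne_zero_of_im hz x
  have hy : 0 < |z.im| := abs_pos.mpr hz
  set K : ℝ := (1 + ‖z‖) / |z.im| + 1 with hK
  have hK0 : 0 < K := by positivity
  have hb : ∀ x : ℝ, ‖((x : ℂ) - z)⁻¹‖ ≤ K * (1 + |x|)⁻¹ := by
    intro x
    rw [norm_inv, ← div_eq_mul_inv, inv_le_comm₀ (norm_pos_iff.mpr (hne x)) (by positivity), inv_div,
      div_le_iff₀ hK0]
    have h1 : |x| ≤ ‖(x : ℂ) - z‖ + ‖z‖ := by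
      have := norm_add_le ((x : ℂ) - z) z
      simpa using this
    have h2 : |z.im| ≤ ‖(x : ℂ) - z‖ := by
      have := Complex.abs_im_le_norm ((x : ℂ) - z)
      simpa using this
    have h3 : 1 + ‖z‖ ≤ ‖(x : ℂ) - z‖ * ((1 + ‖z‖) / |z.im|) := by
      calc 1 + ‖z‖ = |z.im| * ((1 + ‖z‖) / |z.im|) := by field_simp
        _ ≤ _ := by gcongr
    rw [hK, mul_add, mul_one]
    linarith
  have hI : Integrable (fun x : ℝ => (C * K) * (1 + ‖x‖) ^ (-(3/2) : ℝ)) := by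
    apply Integrable.const_mul
    apply integrable_one_add_norm
    simp
    norm_num
  refine hI.mono' ?_ (Eventually.of_forall fun x => ?_)
  · apply Continuous.aestronglyMeasurable
    exact hc.mul (Continuous.inv₀ (by fun_prop) hne)
  · rw [norm_mul]
    calc ‖h x‖ * ‖((x : ℂ) - z)⁻¹‖ ≤ (C * (1 + |x|) ^ (-(1/2) : ℝ)) * (K * (1 + |x|)⁻¹) := by
          apply mul_le_mul (hC x) (hb x) (norm_nonneg _) ((norm_nonneg _).trans (hC x))
      _ = C * K * (1 + ‖x‖) ^ (-(3/2) : ℝ) := by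
          rw [Real.norm_eq_abs, ← Real.rpow_neg_one, show (-(3/2) : ℝ) = -(1/2) + -1 by norm_num,
            Real.rpow_add (by positivity)]
          ring

lemma halfplane_repr (h : ℂ → ℂ) (δ : ℝ) (hδ : 0 < δ)
    (hd : DifferentiableOn ℂ h {w | -δ < w.im})
    (hdec : ∀ ε > 0, ∃ R₀ : ℝ, ∀ w : ℂ, 0 ≤ w.im → R₀ ≤ ‖w‖ → ‖h w‖ ≤ ε)
    (C : ℝ) (hC : ∀ x : ℝ, ‖h x‖ ≤ C * (1 + |x|) ^ (-(1/2) : ℝ)) (z : ℂ) (hz : 0 < z.im) :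
    Integrable (fun x : ℝ => (h x).im * ((x : ℂ) - z)⁻¹) ∧
    ∫ x : ℝ, (h x).im * ((x : ℂ) - z)⁻¹ = Real.pi * h z := by
  have hopen : IsOpen {w : ℂ | -δ < w.im} := isOpen_lt continuous_const Complex.continuous_im
  have hc : Continuous (fun x : ℝ => h x) := by
    refine hd.continuousOn.comp_continuous Complex.continuous_ofReal fun x => ?_
    simpa using hδ
  have hzc : (starRingEnd ℂ z).im ≠ 0 := by simpa using hz.ne'
  have i1 := integrable_line h hc C hC z hz.ne'
  have i2 := integrable_line h hc C hC (starRingEnd ℂ z) hzc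
  have hnez : ∀ x : ℝ, (x : ℂ) - z ≠ 0 := by
    intro x
    rw [← neg_ne_zero, neg_sub]
    exact sub_ne_zero_of_im hz.ne' x
  have hnezc : ∀ w : ℂ, 0 ≤ w.im → w - starRingEnd ℂ z ≠ 0 := by
    intro w hw h0
    have := congrArg Complex.im h0
    simp at this
    linarith
  have far : ∀ u w : ℂ, 2 * ‖u‖ ≤ ‖w‖ → ‖w‖ ≤ 2 * ‖w - u‖ := by
    intro u w h0
    have := norm_add_le (w - u) u
    rw [sub_add_cancel] at this
    linarith
  -- conjugate kernel
  have J2 : ∫ x : ℝ, h x * ((x : ℂ) - starRingEnd ℂ z)⁻¹ = 0 := by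
    apply line_integral_zero (fun w => h w * (w - starRingEnd ℂ z)⁻¹) (min δ z.im)
      (lt_min hδ hz) _ i2
    · intro ε hε
      obtain ⟨R₀, hR₀⟩ := hdec (ε / 2) (by positivity)
      refine ⟨max R₀ (2 * ‖starRingEnd ℂ z‖), fun w hw hwR => ?_⟩
      have h1 := hR₀ w hw ((le_max_left _ _).trans hwR)
      have h2 := far _ w ((le_max_right _ _).trans hwR)
      have h3 : 0 < ‖w - starRingEnd ℂ z‖ := norm_pos_iff.mpr (hnezc w hw)
      rw [norm_mul, norm_inv]
      have h4 : ‖w - starRingEnd ℂ z‖⁻¹ * ‖w‖ ≤ 2 := by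
        rw [inv_mul_le_iff₀ h3]; linarith
      rw [mul_assoc]
      calc _ ≤ ε / 2 * 2 := by gcongr
        _ = ε := by ring
    · apply DifferentiableOn.mul
      · apply hd.mono
        intro w hw
        simp only [Set.mem_ofPred_eq] at hw ⊢
        linarith [min_le_left δ z.im]
      · apply DifferentiableOn.inv (by fun_prop)
        intro w hw h0
        have := congrArg Complex.im h0
        simp only [Set.mem_ofPred_eq] at hw
        simp at this
        linarith [min_le_right δ z.im]
  -- Poisson kernel
  have hker : ∀ x : ℝ, ((x : ℂ) - z)⁻¹ - ((x : ℂ) - starRingEnd ℂ z)⁻¹ =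
      ((2 * (z.im / ((x - z.re) ^ 2 + z.im ^ 2)) : ℝ) : ℂ) * I := by
    intro x
    have e : (((x - z.re) ^ 2 + z.im ^ 2 : ℝ) : ℂ) = ((x : ℂ) - z) * ((x : ℂ) - starRingEnd ℂ z) := by
      apply Complex.ext <;> simp [pow_two] <;> ring
    have e2 : z - starRingEnd ℂ z = 2 * z.im * I := by
      apply Complex.ext <;> simp [two_mul]
    push_cast at e ⊢
    rw [e, inv_sub_inv (hnez x) (hnezc x (by simp))]
    rw [show (x : ℂ) - starRingEnd ℂ z - (x - z) = 2 * z.im * I by rw [← e2]; ring]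
    ring
  have i3 : Integrable (fun x : ℝ => ((x : ℂ) - z)⁻¹ - ((x : ℂ) - starRingEnd ℂ z)⁻¹) := by
    simp_rw [hker]
    exact (((integrable_poisson hz z.re).const_mul 2).ofReal).mul_const I
  have J3 : ∫ x : ℝ, (((x : ℂ) - z)⁻¹ - ((x : ℂ) - starRingEnd ℂ z)⁻¹) = 2 * Real.pi * I := by
    simp_rw [hker]
    rw [integral_mul_const, integral_complex_ofReal, integral_const_mul, integral_poisson hz]
    push_cast; ring
  have J1 : ∫ x : ℝ, h x * ((x : ℂ) - z)⁻¹ = 2 * Real.pi * I * h z := by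
    have hg : ∀ w : ℂ, w ≠ z → w - starRingEnd ℂ z ≠ 0 →
        dslope h z w + h z * (w - starRingEnd ℂ z)⁻¹ =
        h w * (w - z)⁻¹ - h z * ((w - z)⁻¹ - (w - starRingEnd ℂ z)⁻¹) := by
      intro w hw hw2
      rw [dslope_of_ne _ hw, slope_def_field]
      ring
    have hgx : ∀ x : ℝ, dslope h z x + h z * ((x : ℂ) - starRingEnd ℂ z)⁻¹ =
        h x * ((x : ℂ) - z)⁻¹ - h z * (((x : ℂ) - z)⁻¹ - ((x : ℂ) - starRingEnd ℂ z)⁻¹) :=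
      fun x => hg x (sub_ne_zero.mp (hnez x)) (hnezc x (by simp))
    have key : ∫ x : ℝ, (dslope h z x + h z * ((x : ℂ) - starRingEnd ℂ z)⁻¹) = 0 := by
      apply line_integral_zero (fun w => dslope h z w + h z * (w - starRingEnd ℂ z)⁻¹) (min δ z.im)
        (lt_min hδ hz)
      · apply DifferentiableOn.add
        · have : DifferentiableOn ℂ (dslope h z) {w | -δ < w.im} := by
            rw [differentiableOn_dslope]
            · exact hd
            · apply hopen.mem_nhds
              simp only [Set.mem_ofPred_eq]; linarith
          apply this.mono
          intro w hw
          simp only [Set.mem_ofPred_eq] at hw ⊢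
          linarith [min_le_left δ z.im]
        · apply DifferentiableOn.const_mul
          apply DifferentiableOn.inv (by fun_prop)
          intro w hw h0
          have := congrArg Complex.im h0
          simp only [Set.mem_ofPred_eq] at hw
          simp at this
          linarith [min_le_right δ z.im]
      · simp_rw [hgx]
        exact i1.sub (i3.const_mul _)
      · intro ε hε
        obtain ⟨R₀, hR₀⟩ := hdec (ε / 4) (by positivity)
        refine ⟨max (max R₀ (2 * ‖z‖)) (max 1 (16 * (‖h z‖ + 1) * (‖z‖ + 1) / ε)), fun w hw hwR => ?_⟩
        have h1 := hR₀ w hw ((le_max_left _ _).trans ((le_max_left _ _).trans hwR))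
        have hw2 : 2 * ‖z‖ ≤ ‖w‖ := (le_max_right _ _).trans ((le_max_left _ _).trans hwR)
        have hw3 : 1 ≤ ‖w‖ := (le_max_left _ _).trans ((le_max_right _ _).trans hwR)
        have hw4 : 16 * (‖h z‖ + 1) * (‖z‖ + 1) / ε ≤ ‖w‖ :=
          (le_max_right _ _).trans ((le_max_right _ _).trans hwR)
        have h2 := far z w hw2
        have h2' := far (starRingEnd ℂ z) w (by simpa using hw2)
        have h3' : 0 < ‖w - starRingEnd ℂ z‖ := by linarith
        have h3 : 0 < ‖w - z‖ := by linarith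
        have hne := norm_pos_iff.mp h3
        have hne' := norm_pos_iff.mp h3'
        rw [hg w (sub_ne_zero.mp hne) hne']
        have h4 : ‖w - z‖⁻¹ * ‖w‖ ≤ 2 := by
          rw [inv_mul_le_iff₀ h3]; linarith
        have h4' : ‖w - starRingEnd ℂ z‖⁻¹ * ‖w‖ ≤ 2 := by
          rw [inv_mul_le_iff₀ h3']; linarith
        have hk : ‖(w - z)⁻¹ - (w - starRingEnd ℂ z)⁻¹‖ * ‖w‖ * ‖w‖ ≤ 8 * ‖z‖ := by
          rw [inv_sub_inv hne hne', norm_div, norm_mul]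
          have : ‖w - starRingEnd ℂ z - (w - z)‖ ≤ 2 * ‖z‖ := by
            rw [show w - starRingEnd ℂ z - (w - z) = z - starRingEnd ℂ z by ring]
            refine (norm_sub_le _ _).trans ?_
            simp [two_mul]
          calc _ = ‖w - starRingEnd ℂ z - (w - z)‖ * (‖w - z‖⁻¹ * ‖w‖) *
                (‖w - starRingEnd ℂ z‖⁻¹ * ‖w‖) := by
                field_simp
            _ ≤ 2 * ‖z‖ * 2 * 2 := by gcongr
            _ = _ := by ring
        have hw0 : 0 < ‖w‖ := by linarith
        have hk2 : ‖h z‖ * (‖(w - z)⁻¹ - (w - starRingEnd ℂ z)⁻¹‖ * ‖w‖) ≤ ε / 2 := by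
          rw [div_le_iff₀ hε] at hw4
          have a1 : ‖(w - z)⁻¹ - (w - starRingEnd ℂ z)⁻¹‖ * ‖w‖ ≤ 8 * ‖z‖ / ‖w‖ := by
            rwa [le_div_iff₀ hw0]
          calc _ ≤ ‖h z‖ * (8 * ‖z‖ / ‖w‖) := by gcongr
            _ = (8 * (‖h z‖ * ‖z‖)) / ‖w‖ := by ring
            _ ≤ _ := by
              rw [div_le_iff₀ hw0]
              nlinarith [norm_nonneg (h z), norm_nonneg z]
        calc _ ≤ (‖h w * (w - z)⁻¹‖ + ‖h z * ((w - z)⁻¹ - (w - starRingEnd ℂ z)⁻¹)‖) * ‖w‖ := by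
              gcongr; exact norm_sub_le _ _
          _ = ‖h w‖ * (‖w - z‖⁻¹ * ‖w‖) +
              ‖h z‖ * (‖(w - z)⁻¹ - (w - starRingEnd ℂ z)⁻¹‖ * ‖w‖) := by
              rw [norm_mul, norm_mul, norm_inv]; ring
          _ ≤ ε / 4 * 2 + ε / 2 := by gcongr
          _ = ε := by ring
    simp_rw [hgx] at key
    rw [integral_sub i1 (i3.const_mul _), integral_const_mul, J3] at key
    linear_combination key
  have hconj : ∀ x : ℝ, ((h x).im : ℂ) * ((x : ℂ) - z)⁻¹ =
      (2 * I)⁻¹ * (h x * ((x : ℂ) - z)⁻¹ - starRingEnd ℂ (h x * ((x : ℂ) - starRingEnd ℂ z)⁻¹)) := by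
    intro x
    have := Complex.sub_conj (h x)
    have e : ((h x).im : ℂ) = (2 * I)⁻¹ * (h x - starRingEnd ℂ (h x)) := by
      rw [this]; push_cast; field_simp
    rw [e]
    simp only [map_mul, map_inv₀, map_sub, Complex.conj_ofReal, Complex.conj_conj]
    ring
  have i2' : Integrable (fun x : ℝ => starRingEnd ℂ (h x * ((x : ℂ) - starRingEnd ℂ z)⁻¹)) := by
    exact (Complex.conjCLE : ℂ →L[ℝ] ℂ).integrable_comp i2
  simp_rw [hconj]
  refine ⟨(i1.sub i2').const_mul _, ?_⟩
  rw [integral_const_mul, integral_sub i1 i2', integral_conj, J1, J2]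
  simp only [map_zero]
  field_simp
  ring

lemma exists_smooth (h : ℂ → ℂ) (δ : ℝ) (hδ : 0 < δ)
    (hd : DifferentiableOn ℂ h {w | -δ < w.im})
    (hdec : ∀ ε > 0, ∃ R₀ : ℝ, ∀ w : ℂ, 0 ≤ w.im → R₀ ≤ ‖w‖ → ‖h w‖ ≤ ε)
    (C : ℝ) (hC : ∀ x : ℝ, ‖h x‖ ≤ C * (1 + |x|) ^ (-(1/2) : ℝ))
    (him : ∀ x : ℝ, (h x).im ≤ 0)
    (hlim : Tendsto (fun Y : ℝ => -(Y * (h ⟨0, Y⟩).im)) atTop (𝓝 1)) :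
    ∃ ρ : Measure ℝ, IsProbabilityMeasure ρ ∧ ∀ z : ℂ, 0 < z.im → cauchy ρ z = h z := by
  have hc : Continuous (fun x : ℝ => h x) := by
    refine hd.continuousOn.comp_continuous Complex.continuous_ofReal fun x => ?_
    simpa using hδ
  set d : ℝ → ℝ := fun x => -(h x).im / Real.pi with hdd
  have hd0 : ∀ x, 0 ≤ d x := fun x => div_nonneg (by linarith [him x]) Real.pi_pos.le
  have hdc : Continuous d := by
    have := Complex.continuous_im.comp hc
    exact this.neg.div_const _
  have hdm : Measurable (fun x => ENNReal.ofReal (d x)) := hdc.measurable.ennreal_ofReal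
  set ρ : Measure ℝ := volume.withDensity (fun x => ENNReal.ofReal (d x)) with hρ
  have hfin : ∀ᵐ x : ℝ, ENNReal.ofReal (d x) < ⊤ := Eventually.of_forall fun x => ENNReal.ofReal_lt_top
  have heq : ∀ z : ℂ, ∀ x : ℝ, (ENNReal.ofReal (d x)).toReal • (z - (x : ℂ))⁻¹ =
      (Real.pi : ℂ)⁻¹ * ((h x).im * ((x : ℂ) - z)⁻¹) := by
    intro z x
    rw [ENNReal.toReal_ofReal (hd0 x), Complex.real_smul, ← neg_sub (x : ℂ) z, inv_neg, hdd]
    push_cast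
    ring
  have hint : ∀ z : ℂ, 0 < z.im → Integrable (fun t : ℝ => (z - (t : ℂ))⁻¹) ρ := by
    intro z hz
    rw [hρ, integrable_withDensity_iff_integrable_smul' hdm hfin]
    simp_rw [heq z]
    exact (halfplane_repr h δ hδ hd hdec C hC z hz).1.const_mul _
  have hcau : ∀ z : ℂ, 0 < z.im → cauchy ρ z = h z := by
    intro z hz
    rw [cauchy, hρ, integral_withDensity_eq_integral_toReal_smul hdm hfin]
    simp_rw [heq z]
    rw [integral_const_mul, (halfplane_repr h δ hδ hd hdec C hC z hz).2]
    rw [← mul_assoc, inv_mul_cancel₀ (by exact_mod_cast Real.pi_ne_zero), one_mul]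
  refine ⟨ρ, ⟨?_⟩, hcau⟩
  have hlin : ∀ n : ℕ, ∫⁻ x, ENNReal.ofReal (((n : ℝ) + 1) ^ 2 / (x ^ 2 + ((n : ℝ) + 1) ^ 2)) ∂ρ =
      ENNReal.ofReal (-(((n : ℝ) + 1) * (h ⟨0, (n : ℝ) + 1⟩).im)) := by
    intro n
    have hz : 0 < (⟨0, (n : ℝ) + 1⟩ : ℂ).im := by simp only; positivity
    have hi := hint _ hz
    have e := cauchy_im' ρ hi
    rw [hcau _ hz] at e
    simp only [zero_sub, neg_sq] at e
    have e2 : -(((n : ℝ) + 1) * (h ⟨0, (n : ℝ) + 1⟩).im) =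
        ∫ x, ((n : ℝ) + 1) ^ 2 / (x ^ 2 + ((n : ℝ) + 1) ^ 2) ∂ρ := by
      rw [← mul_neg, e, ← integral_const_mul]
      congr 1
      ext x
      ring
    rw [e2, ofReal_integral_eq_lintegral_ofReal]
    · have := (hi.im.neg).const_mul ((n : ℝ) + 1)
      refine this.congr (Eventually.of_forall fun t => ?_)
      have := @kernel_im ⟨0, (n : ℝ) + 1⟩ t
      simp only [Pi.neg_apply, RCLike.im_to_complex]
      rw [this]
      simp only [zero_sub, neg_sq]
      ring
    · exact Eventually.of_forall fun x => by simp only [Pi.zero_apply]; positivity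
  have hcast : Tendsto (fun n : ℕ => (n : ℝ) + 1) atTop atTop :=
    tendsto_atTop_add_const_right _ _ tendsto_natCast_atTop_atTop
  have t1 : Tendsto (fun n : ℕ => ∫⁻ x, ENNReal.ofReal (((n : ℝ) + 1) ^ 2 / (x ^ 2 + ((n : ℝ) + 1) ^ 2)) ∂ρ)
      atTop (𝓝 1) := by
    simp_rw [hlin]
    have := (ENNReal.tendsto_ofReal hlim).comp hcast
    rw [ENNReal.ofReal_one] at this
    exact this
  have t2 : Tendsto (fun n : ℕ => ∫⁻ x, ENNReal.ofReal (((n : ℝ) + 1) ^ 2 / (x ^ 2 + ((n : ℝ) + 1) ^ 2)) ∂ρ)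
      atTop (𝓝 (∫⁻ x, 1 ∂ρ)) := by
    apply lintegral_tendsto_of_tendsto_of_monotone
    · intro n
      apply Measurable.aemeasurable
      apply Measurable.ennreal_ofReal
      fun_prop
    · refine Eventually.of_forall fun x m n hmn => ?_
      apply ENNReal.ofReal_le_ofReal
      have : (m : ℝ) ≤ n := by exact_mod_cast hmn
      have h1 : ((m : ℝ) + 1) ^ 2 ≤ ((n : ℝ) + 1) ^ 2 := by gcongr
      rw [div_le_div_iff₀ (by positivity) (by positivity)]
      nlinarith [sq_nonneg x]
    · refine Eventually.of_forall fun x => ?_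
      rw [← ENNReal.ofReal_one]
      apply ENNReal.tendsto_ofReal
      have hs : Tendsto (fun n : ℕ => ((n : ℝ) + 1) ^ 2) atTop atTop :=
        (tendsto_pow_atTop (by norm_num)).comp hcast
      have hs2 : Tendsto (fun n : ℕ => x ^ 2 / (x ^ 2 + ((n : ℝ) + 1) ^ 2)) atTop (𝓝 0) :=
        tendsto_const_nhds.div_atTop (tendsto_atTop_add_const_left _ _ hs)
      have := hs2.const_sub 1
      rw [sub_zero] at this
      refine this.congr fun n => ?_
      field_simp
      ring
  have := tendsto_nhds_unique t2 t1
  simpa using this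

lemma tail_bound (ρ : Measure ℝ) [IsProbabilityMeasure ρ] {R : ℝ} (hR : 0 < R) :
    ρ (Set.Icc (-R) R)ᶜ ≤ ENNReal.ofReal (2 * (1 + R * (cauchy ρ ⟨0, R⟩).im)) := by
  have hz : 0 < (⟨0, R⟩ : ℂ).im := hR
  have hi := integrable_kernel ρ hz
  have e := cauchy_im' ρ hi
  simp only [zero_sub, neg_sq] at e
  have hi2 : Integrable (fun x : ℝ => R / (x ^ 2 + R ^ 2)) ρ := by
    refine hi.im.neg.congr (Eventually.of_forall fun t => ?_)
    have := @kernel_im ⟨0, R⟩ t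
    simp only [Pi.neg_apply, RCLike.im_to_complex]
    rw [this]
    simp only [zero_sub, neg_sq]
    ring
  have e2 : 2 * (1 + R * (cauchy ρ ⟨0, R⟩).im) = ∫ x, 2 * (1 - R * (R / (x ^ 2 + R ^ 2))) ∂ρ := by
    rw [integral_const_mul, integral_sub (integrable_const _) (hi2.const_mul R), integral_const_mul,
      ← e]
    simp
  have hnn : ∀ x : ℝ, 0 ≤ 2 * (1 - R * (R / (x ^ 2 + R ^ 2))) := by
    intro x
    have : R * (R / (x ^ 2 + R ^ 2)) ≤ 1 := by
      rw [← mul_div_assoc, div_le_one (by positivity)]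
      nlinarith [sq_nonneg x]
    linarith
  have hi3 : Integrable (fun x : ℝ => 2 * (1 - R * (R / (x ^ 2 + R ^ 2)))) ρ :=
    ((integrable_const _).sub (hi2.const_mul R)).const_mul 2
  rw [e2, ofReal_integral_eq_lintegral_ofReal hi3 (Eventually.of_forall hnn)]
  have hms : MeasurableSet (Set.Icc (-R) R)ᶜ := measurableSet_Icc.compl
  rw [← lintegral_indicator_one hms]
  apply lintegral_mono
  intro x
  by_cases hx : x ∈ (Set.Icc (-R) R)ᶜ
  · rw [Set.indicator_of_mem hx]
    simp only [Pi.one_apply]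
    rw [← ENNReal.ofReal_one]
    apply ENNReal.ofReal_le_ofReal
    have hx2 : R ^ 2 ≤ x ^ 2 := by
      rw [sq_le_sq, abs_of_pos hR]
      by_contra hcon
      push Not at hcon
      exact hx (abs_le.mp hcon.le)
    have : R * (R / (x ^ 2 + R ^ 2)) ≤ 1 / 2 := by
      rw [← mul_div_assoc, div_le_iff₀ (by positivity)]
      nlinarith
    linarith
  · rw [Set.indicator_of_notMem hx]
    exact zero_le

lemma exists_repr (F : ℂ → ℂ) (hd : DifferentiableOn ℂ F {w | 0 < w.im})
    (him : ∀ z : ℂ, 0 < z.im → (F z).im ≤ 0)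
    (hb : ∀ z : ℂ, 0 < z.im → ‖F z‖ ^ 2 ≤ (z.im * ‖z‖)⁻¹)
    (hlim : Tendsto (fun Y : ℝ => -(Y * (F ⟨0, Y⟩).im)) atTop (𝓝 1)) :
    ∃ ρ : Measure ℝ, IsProbabilityMeasure ρ ∧ ∀ z : ℂ, 0 < z.im → cauchy ρ z = F z := by
  have step : ∀ e : ℝ, 0 < e → ∃ ρ : Measure ℝ, IsProbabilityMeasure ρ ∧
      ∀ z : ℂ, 0 < z.im → cauchy ρ z = F (z + e * I) := by
    intro e he
    have himw : ∀ w : ℂ, (w + e * I).im = w.im + e := by intro w; simp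
    have hb' : ∀ w : ℂ, 0 ≤ w.im → ‖F (w + e * I)‖ ^ 2 ≤ (e * ‖w + e * I‖)⁻¹ := by
      intro w hw
      have hp : 0 < (w + e * I).im := by rw [himw]; linarith
      refine (hb _ hp).trans ?_
      have : 0 < ‖w + e * I‖ := by
        apply norm_pos_iff.mpr
        intro h0
        rw [h0] at hp
        simp at hp
      rw [himw]
      gcongr
      linarith
    apply exists_smooth (fun w => F (w + e * I)) e he
    · apply DifferentiableOn.comp hd (by fun_prop)
      intro w hw
      simp only [Set.mem_ofPred_eq] at hw ⊢
      rw [himw]; linarith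
    · intro ε hε
      refine ⟨e + (e * ε ^ 2)⁻¹, fun w hw hR => ?_⟩
      have h1 := hb' w hw
      have h2 : (e * ε ^ 2)⁻¹ ≤ ‖w + e * I‖ := by
        have := norm_sub_le (w + e * I) (e * I)
        rw [add_sub_cancel_right, norm_mul, norm_I, mul_one, Complex.norm_real,
          Real.norm_of_nonneg he.le] at this
        linarith
      have h3 : (e * ‖w + e * I‖)⁻¹ ≤ ε ^ 2 := by
        have : 0 < (e * ε ^ 2)⁻¹ := by positivity
        have h4 : 0 < ‖w + e * I‖ := by linarith
        rw [inv_le_iff_one_le_mul₀ (by positivity)] at h2 ⊢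
        linarith
      exact (sq_le_sq₀ (norm_nonneg _) hε.le).mp (h1.trans h3)
    · intro x
      -- the bound on the real line
      have h1 := hb' x (by simp)
      have h2 : 1 + |x| ≤ (1 + e⁻¹) * ‖(x : ℂ) + e * I‖ := by
        have a := Complex.abs_re_le_norm ((x : ℂ) + e * I)
        have b := Complex.abs_im_le_norm ((x : ℂ) + e * I)
        simp at a b
        rw [abs_of_pos he] at b
        have : 1 ≤ e⁻¹ * ‖(x : ℂ) + e * I‖ := by
          rw [← inv_mul_cancel₀ he.ne']; gcongr
        linarith
      have hp : 0 < ‖(x : ℂ) + e * I‖ := by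
        have : 0 < 1 + |x| := by positivity
        have h3 : 0 < 1 + e⁻¹ := by positivity
        by_contra hcon
        push Not at hcon
        nlinarith
      have h3 : (e * ‖(x : ℂ) + e * I‖)⁻¹ ≤ ((1 + e⁻¹) / e) * (1 + |x|)⁻¹ := by
        rw [mul_inv, div_eq_mul_inv, mul_comm (1 + e⁻¹), mul_assoc]
        gcongr
        rw [← div_eq_mul_inv, inv_le_iff_one_le_mul₀ hp, div_mul_eq_mul_div, le_div_iff₀ (by positivity)]
        linarith
      have h4 : (Real.sqrt ((1 + e⁻¹) / e) * (1 + |x|) ^ (-(1/2) : ℝ)) ^ 2 =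
          ((1 + e⁻¹) / e) * (1 + |x|)⁻¹ := by
        rw [mul_pow, Real.sq_sqrt (by positivity), ← Real.rpow_natCast, ← Real.rpow_mul (by positivity)]
        rw [show (-(1/2) : ℝ) * ((2 : ℕ) : ℝ) = -1 by norm_num, Real.rpow_neg_one]
      rw [← h4] at h3
      exact (sq_le_sq₀ (norm_nonneg _) (by positivity)).mp (h1.trans h3)
    · intro x
      apply him
      rw [himw]; simpa using he
    · have hsh : Tendsto (fun Y : ℝ => Y + e) atTop atTop := tendsto_atTop_add_const_right _ _ tendsto_id
      have h1 := hlim.comp hsh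
      have h2 : Tendsto (fun Y : ℝ => 1 - e / (Y + e)) atTop (𝓝 1) := by
        have := (tendsto_const_nhds (x := e)).div_atTop hsh
        simpa using this.const_sub 1
      have h3 := h2.mul h1
      rw [one_mul] at h3
      refine h3.congr' ?_
      filter_upwards [eventually_gt_atTop 0] with Y hY
      have : (⟨0, Y⟩ : ℂ) + e * I = ⟨0, Y + e⟩ := by
        apply Complex.ext <;> simp
      simp only [Function.comp]
      rw [this]
      have : Y + e ≠ 0 := by positivity
      field_simp
      ring
  have hpos : ∀ n : ℕ, 0 < 1 / ((n : ℝ) + 1) := fun n => by positivity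
  choose ρ hρ1 hρ2 using fun n : ℕ => step (1 / ((n : ℝ) + 1)) (hpos n)
  let P : ℕ → ProbabilityMeasure ℝ := fun n => ⟨ρ n, hρ1 n⟩
  have htight : IsTightMeasureSet {((μ : ProbabilityMeasure ℝ) : Measure ℝ) | μ ∈ Set.range P} := by
    rw [isTightMeasureSet_iff_exists_isCompact_measure_compl_le]
    intro ε hε
    obtain ⟨η, hη0, hη⟩ : ∃ η : ℝ, 0 < η ∧ ENNReal.ofReal (4 * η) ≤ ε := by
      by_cases htop : ε = ⊤
      · exact ⟨1, one_pos, by simp [htop]⟩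
      · refine ⟨ε.toReal / 4, by have := ENNReal.toReal_pos hε.ne' htop; positivity, ?_⟩
        rw [mul_div_cancel₀ _ (by norm_num), ENNReal.ofReal_toReal htop]
    have hev : ∀ᶠ Y : ℝ in atTop, 1 - η < -(Y * (F ⟨0, Y⟩).im) :=
      hlim.eventually_const_lt (by linarith)
    obtain ⟨Y₀, hY₀⟩ := eventually_atTop.mp hev
    set R : ℝ := max (max Y₀ 1) (1 / η) with hRdef
    have hR1 : 1 ≤ R := (le_max_right _ _).trans (le_max_left _ _)
    have hR0 : 0 < R := by linarith
    have hRY : Y₀ ≤ R := (le_max_left _ _).trans (le_max_left _ _)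
    have hRη : 1 / η ≤ R := le_max_right _ _
    refine ⟨Set.Icc (-R) R, isCompact_Icc, ?_⟩
    rintro _ ⟨_, ⟨n, rfl⟩, rfl⟩
    change ρ n _ ≤ ε
    have := hρ1 n
    refine (tail_bound (ρ n) hR0).trans (le_trans (ENNReal.ofReal_le_ofReal ?_) hη)
    rw [hρ2 n _ hR0]
    have hen : 1 / ((n : ℝ) + 1) ≤ 1 := by
      rw [div_le_one (by positivity)]; linarith [Nat.cast_nonneg (α := ℝ) n]
    have hen0 := hpos n
    have e1 : ∀ e : ℝ, (⟨0, R⟩ : ℂ) + (e : ℂ) * I = ⟨0, R + e⟩ := by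
      intro e
      apply Complex.ext <;> simp
    rw [e1]
    set e := 1 / ((n : ℝ) + 1)
    have h1 := hY₀ (R + e) (by linarith)
    set f := (F ⟨0, R + e⟩).im
    rw [div_le_iff₀ hη0] at hRη
    -- -f > (1-η)/(R+e), need R * f ≤ -1 + 2η
    by_cases hη1 : η < 1
    · have hfe : (1 - η) / (R + e) < -f := by
        rw [div_lt_iff₀ (by linarith)]; linarith
      have : R * ((1 - η) / (R + e)) ≥ 1 - 2 * η := by
        rw [ge_iff_le, ← mul_div_assoc, le_div_iff₀ (by linarith)]
        nlinarith
      nlinarith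
    · have hf : f ≤ 0 := him _ (by simp only; linarith)
      nlinarith
  have hK := isCompact_closure_of_isTightMeasureSet htight
  obtain ⟨Q, -, hQ⟩ := hK.ultrafilter_le_nhds ((Filter.hyperfilter ℕ).map P) (by
    rw [Filter.le_principal_iff]
    apply Filter.mem_map.mpr
    exact Filter.univ_mem' fun n => subset_closure ⟨n, rfl⟩)
  have hQ' : Tendsto P (Filter.hyperfilter ℕ : Filter ℕ) (𝓝 Q) := hQ
  rw [ProbabilityMeasure.tendsto_iff_forall_integral_rclike_tendsto ℂ] at hQ'
  refine ⟨(Q : Measure ℝ), inferInstance, fun z hz => ?_⟩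
  let f : BoundedContinuousFunction ℝ ℂ := BoundedContinuousFunction.ofNormedAddCommGroup
    (fun t : ℝ => (z - (t : ℂ))⁻¹) (continuous_kernel hz) z.im⁻¹ (norm_inv_le hz)
  have t1 := hQ' f
  have t1' : Tendsto (fun n => cauchy (ρ n) z) (Filter.hyperfilter ℕ : Filter ℕ) (𝓝 (cauchy Q z)) := t1
  have t2 : Tendsto (fun n => cauchy (ρ n) z) atTop (𝓝 (F z)) := by
    simp_rw [hρ2 _ z hz]
    have hcz : ContinuousAt F z := by
      apply (hd.differentiableAt _).continuousAt
      exact (isOpen_lt continuous_const Complex.continuous_im).mem_nhds hz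
    have h0 : Tendsto (fun n : ℕ => z + ((1 / ((n : ℝ) + 1) : ℝ) : ℂ) * I) atTop (𝓝 z) := by
      have a : Tendsto (fun n : ℕ => ((1 / ((n : ℝ) + 1) : ℝ) : ℂ)) atTop (𝓝 ((0 : ℝ) : ℂ)) :=
        (Complex.continuous_ofReal.tendsto 0).comp tendsto_one_div_add_atTop_nhds_zero_nat
      have := (a.mul_const I).const_add z
      simpa using this
    exact hcz.tendsto.comp h0
  exact tendsto_nhds_unique t1' (t2.mono_left (by
    rw [← Nat.cofinite_eq_atTop]; exact Filter.hyperfilter_le_cofinite))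

lemma elGordo_exists (ν : Measure ℝ) [IsProbabilityMeasure ν] :
    ∃ ρ : Measure ℝ, IsProbabilityMeasure ρ ∧
      ∀ z : ℂ, 0 < z.im → (cauchy ρ z) ^ 2 = cauchy ν z / z := by
  set W : ℂ → ℂ := fun z => -(cauchy ν z / z) with hW
  set F : ℂ → ℂ := fun z => -I * (W z) ^ (1 / 2 : ℂ) with hF
  have hne : ∀ z : ℂ, 0 < z.im → z ≠ 0 := by
    rintro z hz rfl
    simp at hz
  have hslit : ∀ z : ℂ, 0 < z.im → W z ∈ slitPlane := by
    intro z hz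
    rw [Complex.mem_slitPlane_iff]
    by_contra hcon
    push Not at hcon
    obtain ⟨h1, h2⟩ := hcon
    have h3 := cauchy_im_neg ν hz
    have h4 : cauchy ν z = -(W z) * z := by
      rw [hW]; simp only [neg_neg]; rw [div_mul_cancel₀ _ (hne z hz)]
    rw [h4] at h3
    simp only [neg_mul, Complex.neg_im, Complex.mul_im, h2] at h3
    nlinarith
  have hsq : ∀ z : ℂ, 0 < z.im → F z ^ 2 = cauchy ν z / z := by
    intro z hz
    rw [hF]
    simp only
    rw [mul_pow, ← Complex.cpow_nat_mul]
    simp [hW]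
  have hFim : ∀ z : ℂ, 0 < z.im → (F z).im < 0 := by
    intro z hz
    have hre : 0 < ((W z) ^ (1 / 2 : ℂ)).re := by
      rw [Complex.cpow_def_of_ne_zero (Complex.slitPlane_ne_zero (hslit z hz)), Complex.exp_re]
      apply mul_pos (Real.exp_pos _)
      have harg := Complex.mem_slitPlane_iff_arg.mp (hslit z hz)
      have e : (Complex.log (W z) * (1 / 2 : ℂ)).im = (W z).arg / 2 := by
        rw [show (1 / 2 : ℂ) = ((1 / 2 : ℝ) : ℂ) by push_cast; rfl, Complex.im_mul_ofReal, Complex.log_im]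
        ring
      rw [e]
      apply Real.cos_pos_of_mem_Ioo
      have a1 := Complex.neg_pi_lt_arg (W z)
      have a2 := lt_of_le_of_ne (Complex.arg_le_pi (W z)) harg.1
      constructor <;> linarith
    rw [hF]
    simp only [neg_mul, Complex.neg_im, Complex.mul_im, Complex.I_re, Complex.I_im]
    linarith
  have hrep := exists_repr F ?_ (fun z hz => (hFim z hz).le) ?_ ?_
  · obtain ⟨ρ, hρ, hρ2⟩ := hrep
    refine ⟨ρ, hρ, fun z hz => ?_⟩
    rw [hρ2 z hz, hsq z hz]
  · intro z hz
    apply DifferentiableAt.differentiableWithinAt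
    apply DifferentiableAt.const_mul
    apply DifferentiableAt.cpow _ (differentiableAt_const _) (hslit z hz)
    exact ((differentiableAt_cauchy ν hz).div differentiableAt_id (hne z hz)).neg
  · intro z hz
    rw [← norm_pow, hsq z hz, norm_div, mul_inv, div_eq_mul_inv]
    gcongr
    refine (norm_integral_le_of_norm_le_const (Eventually.of_forall (norm_inv_le hz))).trans ?_
    simp
  · have hG : Tendsto (fun Y : ℝ => (⟨0, Y⟩ : ℂ) * cauchy ν ⟨0, Y⟩) atTop (𝓝 1) := by
      have e : ∀ Y : ℝ, (⟨0, Y⟩ : ℂ) * cauchy ν ⟨0, Y⟩ = ∫ t, (⟨0, Y⟩ : ℂ) * (⟨0, Y⟩ - (t : ℂ))⁻¹ ∂ν := by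
        intro Y; rw [cauchy, integral_const_mul]
      simp_rw [e]
      have e1 : (1 : ℂ) = ∫ _t : ℝ, (1 : ℂ) ∂ν := by simp
      rw [e1]
      have hnorm : ∀ Y : ℝ, 0 < Y → ‖(⟨0, Y⟩ : ℂ)‖ = Y := by
        intro Y hY
        have : (⟨0, Y⟩ : ℂ) = Y * I := by apply Complex.ext <;> simp
        rw [this, norm_mul, norm_I, mul_one, Complex.norm_real, Real.norm_of_nonneg hY.le]
      apply tendsto_integral_filter_of_dominated_convergence (fun _ => (1 : ℝ))
      · filter_upwards [eventually_gt_atTop 0] with Y hY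
        exact ((continuous_kernel (z := ⟨0, Y⟩) hY).const_mul _).aestronglyMeasurable
      · filter_upwards [eventually_gt_atTop 0] with Y hY
        refine Eventually.of_forall fun t => ?_
        rw [norm_mul, hnorm Y hY]
        have := norm_inv_le (z := ⟨0, Y⟩) hY t
        calc _ ≤ Y * Y⁻¹ := by gcongr
          _ = 1 := mul_inv_cancel₀ hY.ne'
      · exact integrable_const _
      · refine Eventually.of_forall fun t => ?_
        rw [tendsto_iff_norm_sub_tendsto_zero]
        have hb : Tendsto (fun Y : ℝ => |t| / Y) atTop (𝓝 0) := tendsto_const_nhds.div_atTop tendsto_id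
        apply squeeze_zero' (Eventually.of_forall fun _ => norm_nonneg _) _ hb
        filter_upwards [eventually_gt_atTop 0] with Y hY
        have hn := sub_ne_zero_of_im (z := ⟨0, Y⟩) (ne_of_gt hY) t
        have : (⟨0, Y⟩ : ℂ) * (⟨0, Y⟩ - (t : ℂ))⁻¹ - 1 = t * (⟨0, Y⟩ - (t : ℂ))⁻¹ := by
          field_simp
          ring
        rw [this, norm_mul, Complex.norm_real, Real.norm_eq_abs, div_eq_mul_inv]
        gcongr
        exact norm_inv_le (z := ⟨0, Y⟩) hY t
    -- from squares to the function
    have hs : Tendsto (fun Y : ℝ => (⟨0, Y⟩ : ℂ) * F ⟨0, Y⟩) atTop (𝓝 1) := by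
      rw [tendsto_iff_norm_sub_tendsto_zero] at hG ⊢
      apply squeeze_zero' (Eventually.of_forall fun _ => norm_nonneg _) _ hG
      filter_upwards [eventually_gt_atTop 0] with Y hY
      have hz : 0 < (⟨0, Y⟩ : ℂ).im := hY
      have h1 : ((⟨0, Y⟩ : ℂ) * F ⟨0, Y⟩) ^ 2 = ⟨0, Y⟩ * cauchy ν ⟨0, Y⟩ := by
        rw [mul_pow, hsq _ hz]
        have := hne _ hz
        field_simp
      rw [← h1]
      set s := (⟨0, Y⟩ : ℂ) * F ⟨0, Y⟩ with hsdef
      have hre : 0 < s.re := by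
        rw [hsdef, Complex.mul_re]
        simp only [zero_mul, zero_sub]
        have := hFim _ hz
        nlinarith
      have h2 : 1 ≤ ‖s + 1‖ := by
        have := Complex.re_le_norm (s + 1)
        simp at this
        linarith
      rw [show s ^ 2 - 1 = (s - 1) * (s + 1) by ring, norm_mul]
      exact le_mul_of_one_le_right (norm_nonneg _) h2
    have := (Complex.continuous_re.tendsto 1).comp hs
    rw [Complex.one_re] at this
    refine this.congr fun Y => ?_
    simp [Complex.mul_re]

lemma sqBias_facts (μ : Measure ℝ) [IsProbabilityMeasure μ]
    (h1 : Integrable (fun t => t) μ) (hmean : (∫ t, t ∂μ) = 0)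
    (h2 : Integrable (fun t => t ^ 2) μ) (hpos : 0 < ∫ t, t ^ 2 ∂μ) :
    IsProbabilityMeasure (sqBias μ) ∧ ∀ z : ℂ, 0 < z.im →
      cauchy (sqBias μ) z / z = (z * cauchy μ z - 1) / ((∫ t, t ^ 2 ∂μ : ℝ) : ℂ) := by
  set v := ∫ t, t ^ 2 ∂μ with hv
  have hsb : sqBias μ = μ.withDensity fun t => ENNReal.ofReal (t ^ 2 / v) := by
    rw [sqBias, if_neg hpos.ne']
  have hm : Measurable fun t : ℝ => ENNReal.ofReal (t ^ 2 / v) := by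
    apply Measurable.ennreal_ofReal; fun_prop
  rw [hsb]
  constructor
  · constructor
    rw [withDensity_apply _ MeasurableSet.univ, setLIntegral_univ,
      ← ofReal_integral_eq_lintegral_ofReal (h2.div_const _)
        (Eventually.of_forall fun t => by simp only [Pi.zero_apply]; positivity),
      integral_div, ← hv, div_self hpos.ne', ENNReal.ofReal_one]
  · intro z hz
    have hz0 : z ≠ 0 := by
      rintro rfl; simp at hz
    have hv0 : (v : ℂ) ≠ 0 := by exact_mod_cast hpos.ne'
    rw [cauchy, integral_withDensity_eq_integral_toReal_smul hm
      (Eventually.of_forall fun _ => ENNReal.ofReal_lt_top)]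
    have e : ∀ t : ℝ, (ENNReal.ofReal (t ^ 2 / v)).toReal • (z - (t : ℂ))⁻¹ =
        (v : ℂ)⁻¹ * (z ^ 2 * (z - (t : ℂ))⁻¹ - (z + (t : ℂ))) := by
      intro t
      rw [ENNReal.toReal_ofReal (by positivity), Complex.real_smul]
      have := sub_ne_zero_of_im hz.ne' t
      push_cast
      field_simp
      ring
    simp_rw [e]
    have i1 : Integrable (fun t : ℝ => (t : ℂ)) μ := h1.ofReal
    have i2 := (integrable_kernel μ hz).const_mul (z ^ 2)
    have i3 : Integrable (fun t : ℝ => z + (t : ℂ)) μ := (integrable_const z).add i1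
    rw [integral_const_mul, integral_sub i2 i3, integral_add (integrable_const z) i1,
      integral_complex_ofReal, hmean, integral_const_mul]
    rw [show ∫ t : ℝ, (z - (t : ℂ))⁻¹ ∂μ = cauchy μ z from rfl]
    simp
    field_simp

/-- for μ with mean 0 and variance σ² ∈ (0,∞) there is a unique probability
measure μ° (the free zero bias) with G_{μ°}(z)² = (z·G_μ(z) − 1)/σ² on ℂ₊, and this
measure is the El Gordo transform of the square bias μ^□, i.e. it also satisfies
G_{μ°}(z)² = G_{μ^□}(z)/z on ℂ₊. -/
theorem freeZeroBias_exists_unique (μ : Measure ℝ) [IsProbabilityMeasure μ]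
    (h1 : Integrable (fun t => t) μ) (hmean : (∫ t, t ∂μ) = 0)
    (h2 : Integrable (fun t => t ^ 2) μ) (hpos : 0 < ∫ t, t ^ 2 ∂μ) :
    ∃ ρ : Measure ℝ,
      (IsProbabilityMeasure ρ ∧
        (∀ z : ℂ, 0 < z.im →
          (cauchy ρ z) ^ 2 = (z * cauchy μ z - 1) / ((∫ t, t ^ 2 ∂μ : ℝ) : ℂ)) ∧
        (∀ z : ℂ, 0 < z.im → (cauchy ρ z) ^ 2 = cauchy (sqBias μ) z / z)) ∧
      ∀ ρ' : Measure ℝ, IsProbabilityMeasure ρ' →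
        (∀ z : ℂ, 0 < z.im →
          (cauchy ρ' z) ^ 2 = (z * cauchy μ z - 1) / ((∫ t, t ^ 2 ∂μ : ℝ) : ℂ)) →
        ρ' = ρ := by
  obtain ⟨hp, hf⟩ := sqBias_facts μ h1 hmean h2 hpos
  obtain ⟨ρ, hρ, hρ2⟩ := elGordo_exists (sqBias μ)
  refine ⟨ρ, ⟨hρ, fun z hz => ?_, hρ2⟩, fun ρ' hρ' h' => ?_⟩
  · rw [hρ2 z hz, hf z hz]
  · apply cauchy_unique
    intro z hz
    have e : cauchy ρ' z ^ 2 = cauchy ρ z ^ 2 := by rw [h' z hz, hρ2 z hz, hf z hz]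
    rcases sq_eq_sq_iff_eq_or_eq_neg.mp e with h | h
    · exact h
    · have a := cauchy_im_neg ρ' hz
      have b := cauchy_im_neg ρ hz
      rw [h, Complex.neg_im] at a
      linarith
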